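/- For every integer i with 0 ≤ i ≤ ⌊g/3⌋ one has J ∩ 𝒜_{(0,2i)} = 0; that is, the quotient map B → R̃ = B/J restricts to an injection on the component 𝒜_{(0,2i)} (there are no relations in degrees i ≤ ⌊g/3⌋). -/

import Mathlib

open MvPolynomial

/-- The index set `S_g` of pairs `(i,j)` of integers. -/
def Sg (g : ℕ) : Set (ℤ × ℤ) :=
  {p | 0 ≤ p.1 ∧ 0 ≤ p.2 ∧ p.2 ≤ 2 * (g : ℤ) - 2 ∧ p.1 ≤ p.2 + 2 ∧
    Even (p.1 + p.2) ∧ p ≠ (0, 0)}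

/-- The variables of the polynomial algebra `𝒜`: one variable `x_{i,j}` for each
`(i,j) ∈ S_g`, plus one extra variable `y`. -/
abbrev JacVar (g : ℕ) := {p : ℤ × ℤ // p ∈ Sg g} ⊕ Unit

/-- The polynomial algebra `𝒜` over `ℚ`. -/
abbrev JacA (g : ℕ) := MvPolynomial (JacVar g) ℚ

open Classical in
/-- The element `x_{i,j}` of `𝒜`, with the conventions `x_{0,0} = g` and `x_{i,j} = 0` for
`(i,j) ∉ S_g ∪ {(0,0)}`. -/
noncomputable def Xv (g : ℕ) (i j : ℤ) : JacA g :=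
  if h : (i, j) ∈ Sg g then X (Sum.inl ⟨(i, j), h⟩)
  else if (i, j) = ((0 : ℤ), (0 : ℤ)) then C (g : ℚ) else 0

/-- The element `y` of `𝒜`. -/
noncomputable def Yv (g : ℕ) : JacA g := X (Sum.inr ())

/-- The bigrading: `x_{i,j}` has bidegree `(i,j)` and `y` has bidegree `(0,2)`. -/
def wt (g : ℕ) : JacVar g → ℤ × ℤ
  | Sum.inl p => p.1
  | Sum.inr _ => (0, 2)

/-- The bihomogeneous component `𝒜_{(i,j)}`. -/
noncomputable def Acomp (g : ℕ) (i j : ℤ) : Submodule ℚ (JacA g) :=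
  weightedHomogeneousSubmodule ℚ (wt g) (i, j)

/-- Binomial coefficient `binom(n,r)` for integers, equal to `0` unless `0 ≤ r ≤ n`. -/
def ibinom (n r : ℤ) : ℚ :=
  if 0 ≤ r ∧ r ≤ n then (n.toNat.choose r.toNat : ℚ) else 0

open Classical in
/-- The (finite) set `S_g` as a `Finset` of pairs of integers. -/
noncomputable def SgFinset (g : ℕ) : Finset (ℤ × ℤ) :=
  ((Finset.Icc (0 : ℤ) (2 * (g : ℤ))) ×ˢ (Finset.Icc (0 : ℤ) (2 * (g : ℤ)))).filter
    (· ∈ Sg g)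

open Classical in
/-- Partial derivative `∂x_{i,j}` (zero if `(i,j) ∉ S_g`). -/
noncomputable def pd (g : ℕ) (p : ℤ × ℤ) (P : JacA g) : JacA g :=
  if h : p ∈ Sg g then pderiv (Sum.inl ⟨p, h⟩) P else 0

/-- The operator `E`: multiplication by `x_{2,0}`. -/
noncomputable def Eop (g : ℕ) (P : JacA g) : JacA g := Xv g 2 0 * P

/-- The differential operator `F`. -/
noncomputable def Fop (g : ℕ) (P : JacA g) : JacA g :=
  (1 / 2 : ℚ) • (∑ p ∈ SgFinset g, ∑ q ∈ SgFinset g,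
      (Yv g * Xv g (p.1 - 1) (p.2 - 1) * Xv g (q.1 - 1) (q.2 - 1)
        - C (ibinom (p.1 + q.1 - 2) (p.1 - 1)) * Xv g (p.1 + q.1 - 2) (p.2 + q.2))
      * pd g p (pd g q P))
  + ∑ p ∈ SgFinset g, Xv g (p.1 - 2) p.2 * pd g p P

/-- The subalgebra `B = ⊕_{i≥0} 𝒜_{(0,2i)}` of `𝒜`, i.e. the polynomial subalgebra
generated by the variables `x_{0,2}, x_{0,4}, …, x_{0,2g−2}` and `y`. -/
noncomputable def Bsub (g : ℕ) : Subalgebra ℚ (JacA g) :=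
  Algebra.adjoin ℚ
    ({Yv g} ∪ {P | ∃ k : ℤ, 1 ≤ k ∧ k ≤ (g : ℤ) - 1 ∧ P = Xv g 0 (2 * k)})

/-- The ideal `J ⊆ B` generated by the elements `F^{g+1}(m)`, where `m` runs over the
monomials of `𝒜` of bidegree `(2g+2, 2i)` for all `i ≥ 0`. -/
noncomputable def Jid (g : ℕ) : Ideal (Bsub g) :=
  Ideal.span {b : Bsub g | ∃ (i : ℕ) (m : JacVar g →₀ ℕ),
    (monomial m (1 : ℚ)) ∈ Acomp g (2 * (g : ℤ) + 2) (2 * (i : ℤ)) ∧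
    (b : JacA g) = (Fop g)^[g + 1] (monomial m (1 : ℚ))}

section PartialDerivatives

variable {g : ℕ}

lemma mem_SgFinset {p : ℤ × ℤ} : p ∈ SgFinset g ↔ p ∈ Sg g := by
  classical
  simp only [SgFinset, Finset.mem_filter, Finset.mem_product, Finset.mem_Icc,
    and_iff_right_iff_imp]
  rintro ⟨h1, h2, h3, h4, -, -⟩
  omega

lemma two_zero_mem_Sg (hg : 1 ≤ g) : ((2, 0) : ℤ × ℤ) ∈ Sg g := by
  refine ⟨by simp, by simp, ?_, by simp, by decide, by simp⟩
  simp only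
  omega

open Classical in
/-- The partial derivative `pd` as a derivation. -/
noncomputable def pdDerivation (g : ℕ) (p : ℤ × ℤ) : Derivation ℚ (JacA g) (JacA g) :=
  if h : p ∈ Sg g then pderiv (Sum.inl ⟨p, h⟩) else 0

lemma pd_eq_pdDerivation (p : ℤ × ℤ) (P : JacA g) : pd g p P = pdDerivation g p P := by
  classical
  unfold pd pdDerivation
  split_ifs <;> simp

lemma pdDerivation_Xv {p q : ℤ × ℤ} (hp : p ∈ Sg g) (hq : q ∈ Sg g) :
    pdDerivation g p (Xv g q.1 q.2) = if p = q then 1 else 0 := by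
  classical
  rw [pdDerivation, dif_pos hp, Xv, dif_pos (show (q.1, q.2) ∈ Sg g from hq), pderiv_X]
  simp [Pi.single_apply, eq_comm]

/-- The derivation of `𝒜` acting on `𝒜_{(i,j)}` as multiplication by `i`. -/
noncomputable def eulerDerivation (g : ℕ) : Derivation ℚ (JacA g) (JacA g) :=
  ∑ p ∈ SgFinset g, (C (p.1 : ℚ) * Xv g p.1 p.2) • pdDerivation g p

lemma eulerDerivation_apply (P : JacA g) :
    eulerDerivation g P =
      ∑ p ∈ SgFinset g, C (p.1 : ℚ) * Xv g p.1 p.2 * pdDerivation g p P := by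
  rw [eulerDerivation, ← Derivation.coeFnAddMonoidHom_apply, map_sum, Finset.sum_apply]
  simp

lemma eulerDerivation_X (v : JacVar g) :
    eulerDerivation g (X v) = C ((wt g v).1 : ℚ) * X v := by
  classical
  rw [eulerDerivation_apply]
  obtain ⟨q, hq⟩ | u := v
  · have hX : (X (Sum.inl ⟨q, hq⟩) : JacA g) = Xv g q.1 q.2 := by
      rw [Xv, dif_pos (show (q.1, q.2) ∈ Sg g from hq)]
    rw [hX, Finset.sum_eq_single q]
    · rw [pdDerivation_Xv hq hq, if_pos rfl, mul_one, wt]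
    · intro p hp hpq
      rw [pdDerivation_Xv (mem_SgFinset.1 hp) hq, if_neg hpq, mul_zero]
    · intro h
      exact absurd (mem_SgFinset.2 hq) h
  · rw [Finset.sum_eq_zero]
    · simp [wt]
    · intro p hp
      rw [pdDerivation, dif_pos (mem_SgFinset.1 hp), pderiv_X_of_ne (by simp), mul_zero]

lemma eulerDerivation_monomial (m : JacVar g →₀ ℕ) :
    eulerDerivation g (monomial m 1) =
      C ((Finsupp.weight (wt g) m).1 : ℚ) * monomial m 1 := by
  induction m using Finsupp.induction_linear with
  | zero =>
    rw [show (monomial 0 1 : JacA g) = 1 from rfl]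
    simp
  | add a b ha hb =>
    rw [show (monomial (a + b) 1 : JacA g) = monomial a 1 * monomial b 1 by
      rw [monomial_mul, mul_one], Derivation.leibniz, ha, hb, map_add]
    simp only [Prod.fst_add, Int.cast_add, C_add, smul_eq_mul]
    ring
  | single v n =>
    rw [← X_pow_eq_monomial, Derivation.leibniz_pow, eulerDerivation_X, Finsupp.weight_single]
    rcases n with _ | n
    · simp
    · have hfst : ((n + 1) • wt g v).1 = (n + 1) * (wt g v).1 := by simp
      rw [hfst]
      simp only [smul_eq_mul, nsmul_eq_mul, Nat.add_sub_cancel, Int.cast_mul, Int.cast_add,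
        Int.cast_natCast, Int.cast_one, Nat.cast_add, Nat.cast_one, C_mul, C_add, map_natCast, C_1]
      ring

lemma eulerDerivation_of_mem_Acomp {a b : ℤ} {P : JacA g} (hP : P ∈ Acomp g a b) :
    eulerDerivation g P = C (a : ℚ) * P := by
  conv_lhs => rw [P.as_sum]
  conv_rhs => rw [P.as_sum]
  rw [map_sum, Finset.mul_sum]
  refine Finset.sum_congr rfl fun m hm => ?_
  have hw : Finsupp.weight (wt g) m = (a, b) := hP (mem_support_iff.1 hm)
  have hmon : (monomial m (coeff m P) : JacA g) = coeff m P • monomial m 1 := by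
    rw [smul_monomial, smul_eq_mul, mul_one]
  rw [hmon, Derivation.map_smul, eulerDerivation_monomial, hw, mul_smul_comm]

end PartialDerivatives

section Homogeneity

variable {g : ℕ}

lemma mul_mem_Acomp {a b c d e f : ℤ} {P Q : JacA g} (hP : P ∈ Acomp g a b)
    (hQ : Q ∈ Acomp g c d) (h1 : a + c = e) (h2 : b + d = f) : P * Q ∈ Acomp g e f := by
  subst h1 h2
  exact IsWeightedHomogeneous.mul hP hQ

lemma Xv_mem_Acomp (i j : ℤ) : Xv g i j ∈ Acomp g i j := by
  classical
  unfold Xv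
  split_ifs with h h'
  · exact isWeightedHomogeneous_X ℚ (wt g) _
  · rw [Prod.mk.injEq] at h'
    obtain ⟨rfl, rfl⟩ := h'
    exact isWeightedHomogeneous_C (wt g) _
  · exact zero_mem _

lemma C_mem_Acomp (r : ℚ) : (C r : JacA g) ∈ Acomp g 0 0 :=
  isWeightedHomogeneous_C (wt g) r

lemma Yv_mem_Acomp : Yv g ∈ Acomp g 0 2 :=
  isWeightedHomogeneous_X ℚ (wt g) _

lemma pdDerivation_mem_Acomp {a b : ℤ} {P : JacA g} (hP : P ∈ Acomp g a b) (p : ℤ × ℤ) :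
    pdDerivation g p P ∈ Acomp g (a - p.1) (b - p.2) := by
  classical
  unfold pdDerivation
  split_ifs with h
  · exact IsWeightedHomogeneous.pderiv hP (by simp [wt, Prod.ext_iff])
  · exact zero_mem _

lemma Fop_mem_Acomp {a b : ℤ} {P : JacA g} (hP : P ∈ Acomp g a b) :
    Fop g P ∈ Acomp g (a - 2) b := by
  simp only [Fop, pd_eq_pdDerivation]
  refine add_mem (Submodule.smul_mem _ _ (sum_mem fun p _ => sum_mem fun q _ => ?_))
    (sum_mem fun p _ => ?_)
  · refine mul_mem_Acomp (a := p.1 + q.1 - 2) (b := p.2 + q.2) (sub_mem ?_ ?_)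
      (pdDerivation_mem_Acomp (pdDerivation_mem_Acomp hP q) p) (by ring) (by ring)
    · exact mul_mem_Acomp (mul_mem_Acomp Yv_mem_Acomp (Xv_mem_Acomp _ _) rfl rfl)
        (Xv_mem_Acomp _ _) (by ring) (by ring)
    · exact mul_mem_Acomp (C_mem_Acomp _) (Xv_mem_Acomp _ _) (by ring) (by ring)
  · exact mul_mem_Acomp (Xv_mem_Acomp _ _) (pdDerivation_mem_Acomp hP p) (by ring) (by ring)

lemma Fop_iterate_mem_Acomp {a b : ℤ} {P : JacA g} (hP : P ∈ Acomp g a b) (n : ℕ) :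
    (Fop g)^[n] P ∈ Acomp g (a - 2 * n) b := by
  induction n with
  | zero => simpa using hP
  | succ n ih =>
    rw [Function.iterate_succ_apply']
    convert Fop_mem_Acomp ih using 2
    push_cast
    ring

lemma map_weight_nonneg (L : ℤ × ℤ →+ ℤ) (m : JacVar g →₀ ℕ)
    (h : ∀ v ∈ m.support, 0 ≤ L (wt g v)) : 0 ≤ L (Finsupp.weight (wt g) m) := by
  rw [Finsupp.weight_apply, Finsupp.sum, map_sum]
  refine Finset.sum_nonneg fun v hv => ?_
  rw [map_nsmul]
  exact nsmul_nonneg (h v hv) _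

lemma weight_fst_nonneg (m : JacVar g →₀ ℕ) : 0 ≤ (Finsupp.weight (wt g) m).1 := by
  refine map_weight_nonneg (AddMonoidHom.fst ℤ ℤ) m fun v _ => ?_
  obtain ⟨p, hp⟩ | u := v
  · exact hp.1
  · exact le_rfl

lemma weight_snd_nonneg (m : JacVar g →₀ ℕ) : 0 ≤ (Finsupp.weight (wt g) m).2 := by
  refine map_weight_nonneg (AddMonoidHom.snd ℤ ℤ) m fun v _ => ?_
  obtain ⟨p, hp⟩ | u := v
  · exact hp.2.1
  · exact zero_le_two

/-- A monomial not divisible by `x_{2,0}` has bidegree `(i,j)` with `i ≤ 3j`. -/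
lemma weight_fst_le_three_mul_snd (h20 : ((2, 0) : ℤ × ℤ) ∈ Sg g) (m : JacVar g →₀ ℕ)
    (hm : m (Sum.inl ⟨(2, 0), h20⟩) = 0) :
    (Finsupp.weight (wt g) m).1 ≤ 3 * (Finsupp.weight (wt g) m).2 := by
  have h := map_weight_nonneg (3 • AddMonoidHom.snd ℤ ℤ - AddMonoidHom.fst ℤ ℤ) m ?_
  · simpa using h
  · rintro (⟨⟨a, b⟩, hp⟩ | u) hv
    · have hne : (a, b) ≠ ((2, 0) : ℤ × ℤ) := by
        intro hab
        refine Finsupp.mem_support_iff.1 hv ?_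
        simpa only [hab] using hm
      obtain ⟨h1, h2, -, h4, ⟨c, h5⟩, h6⟩ := hp
      simp only [ne_eq, Prod.mk.injEq] at h1 h2 h4 h5 h6 hne
      simp only [wt, AddMonoidHom.sub_apply, AddMonoidHom.coe_smul, Pi.smul_apply,
        AddMonoidHom.coe_snd, AddMonoidHom.coe_fst, nsmul_eq_mul, Nat.cast_ofNat]
      omega
    · simp [wt]

lemma eq_zero_of_mem_Acomp_of_neg {a b : ℤ} (ha : a < 0) {P : JacA g} (hP : P ∈ Acomp g a b) :
    P = 0 :=
  IsWeightedHomogeneous.eq_zero_of_no_monomials hP fun d hd => by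
    have := weight_fst_nonneg d
    rw [hd] at this
    exact absurd this (not_le.2 ha)

end Homogeneity

section Commutator

variable {g : ℕ}

lemma Fop_add (P Q : JacA g) : Fop g (P + Q) = Fop g P + Fop g Q := by
  simp only [Fop, pd_eq_pdDerivation, map_add, mul_add, Finset.sum_add_distrib, smul_add]
  abel

lemma Fop_C_mul (r : ℚ) (P : JacA g) : Fop g (C r * P) = C r * Fop g P := by
  simp only [Fop, pd_eq_pdDerivation, ← smul_eq_C_mul, Derivation.map_smul, mul_smul_comm,
    ← Finset.smul_sum, smul_add]
  rw [smul_comm]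

lemma Fop_iterate_add (n : ℕ) (P Q : JacA g) :
    (Fop g)^[n] (P + Q) = (Fop g)^[n] P + (Fop g)^[n] Q := by
  induction n with
  | zero => rfl
  | succ n ih => simp only [Function.iterate_succ_apply', ih, Fop_add]

lemma Fop_iterate_C_mul (n : ℕ) (r : ℚ) (P : JacA g) :
    (Fop g)^[n] (C r * P) = C r * (Fop g)^[n] P := by
  induction n with
  | zero => rfl
  | succ n ih => simp only [Function.iterate_succ_apply', ih, Fop_C_mul]

/-- The coefficient of `∂x_p ∂x_q` in `2F`. -/
noncomputable def Fcoeff (g : ℕ) (p q : ℤ × ℤ) : JacA g :=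
  Yv g * Xv g (p.1 - 1) (p.2 - 1) * Xv g (q.1 - 1) (q.2 - 1)
    - C (ibinom (p.1 + q.1 - 2) (p.1 - 1)) * Xv g (p.1 + q.1 - 2) (p.2 + q.2)

lemma Xv_one_neg_one : Xv g 1 (-1) = 0 := by
  rw [Xv, dif_neg (fun h => by simpa using h.2.1), if_neg (by simp)]

lemma Xv_zero_zero : Xv g 0 0 = C (g : ℚ) := by
  rw [Xv, dif_neg (fun h => h.2.2.2.2.2 rfl), if_pos rfl]

lemma Fcoeff_two_zero_left {q : ℤ × ℤ} (hq : q ∈ Sg g) :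
    Fcoeff g (2, 0) q = -(C (q.1 : ℚ) * Xv g q.1 q.2) := by
  have hb : ibinom q.1 1 = (q.1 : ℚ) := by
    obtain ⟨n, hn⟩ := Int.eq_ofNat_of_zero_le hq.1
    rw [hn, ibinom]
    rcases n with _ | n <;> simp
  simp [Fcoeff, Xv_one_neg_one, hb]

lemma Fcoeff_two_zero_right {p : ℤ × ℤ} (hp : p ∈ Sg g) :
    Fcoeff g p (2, 0) = -(C (p.1 : ℚ) * Xv g p.1 p.2) := by
  have hb : ibinom p.1 (p.1 - 1) = (p.1 : ℚ) := by
    obtain ⟨n, hn⟩ := Int.eq_ofNat_of_zero_le hp.1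
    rw [hn, ibinom]
    rcases n with _ | n
    · simp
    · simp
  simp [Fcoeff, Xv_one_neg_one, hb]

lemma Fop_eq (P : JacA g) :
    Fop g P = (1 / 2 : ℚ) • (∑ p ∈ SgFinset g, ∑ q ∈ SgFinset g,
        Fcoeff g p q * pdDerivation g p (pdDerivation g q P))
      + ∑ p ∈ SgFinset g, Xv g (p.1 - 2) p.2 * pdDerivation g p P := by
  simp only [Fop, Fcoeff, pd_eq_pdDerivation]

/-- The commutation relation `[F, E] = -H`. -/
lemma Fop_Eop (hg : 1 ≤ g) (P : JacA g) :
    Fop g (Eop g P) = Eop g (Fop g P) + (C (g : ℚ) * P - eulerDerivation g P) := by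
  classical
  have h20 := two_zero_mem_Sg hg
  have hpd : ∀ p ∈ SgFinset g, ∀ Q : JacA g, pdDerivation g p (Xv g 2 0 * Q) =
      Xv g 2 0 * pdDerivation g p Q + if p = (2, 0) then Q else 0 := by
    intro p hp Q
    rw [Derivation.leibniz, pdDerivation_Xv (mem_SgFinset.1 hp) h20]
    split_ifs <;> simp
  have hsecond : ∑ p ∈ SgFinset g, ∑ q ∈ SgFinset g,
      Fcoeff g p q * pdDerivation g p (pdDerivation g q (Xv g 2 0 * P)) =
      Xv g 2 0 * (∑ p ∈ SgFinset g, ∑ q ∈ SgFinset g,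
        Fcoeff g p q * pdDerivation g p (pdDerivation g q P))
      - eulerDerivation g P - eulerDerivation g P := by
    have hterm : ∀ p ∈ SgFinset g, ∀ q ∈ SgFinset g,
        Fcoeff g p q * pdDerivation g p (pdDerivation g q (Xv g 2 0 * P)) =
        Xv g 2 0 * (Fcoeff g p q * pdDerivation g p (pdDerivation g q P))
        + (if p = (2, 0) then Fcoeff g (2, 0) q * pdDerivation g q P else 0)
        + (if q = (2, 0) then Fcoeff g p (2, 0) * pdDerivation g p P else 0) := by
      intro p hp q hq
      rw [hpd q hq, map_add, hpd p hp]
      split_ifs with h1 h2 h2 <;> simp [h1, h2] <;> ring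
    rw [Finset.sum_congr rfl fun p hp => Finset.sum_congr rfl (hterm p hp)]
    simp only [Finset.sum_add_distrib, ← Finset.mul_sum, sub_eq_add_neg]
    congr 1
    · congr 1
      rw [Finset.sum_comm, eulerDerivation_apply, ← Finset.sum_neg_distrib]
      refine Finset.sum_congr rfl fun q hq => ?_
      rw [Finset.sum_ite_eq' , if_pos (mem_SgFinset.2 h20),
        Fcoeff_two_zero_left (mem_SgFinset.1 hq), neg_mul]
    · rw [eulerDerivation_apply, ← Finset.sum_neg_distrib]
      refine Finset.sum_congr rfl fun p hp => ?_
      rw [Finset.sum_ite_eq', if_pos (mem_SgFinset.2 h20),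
        Fcoeff_two_zero_right (mem_SgFinset.1 hp), neg_mul]
  have hfirst : ∑ p ∈ SgFinset g, Xv g (p.1 - 2) p.2 * pdDerivation g p (Xv g 2 0 * P) =
      Xv g 2 0 * (∑ p ∈ SgFinset g, Xv g (p.1 - 2) p.2 * pdDerivation g p P)
      + C (g : ℚ) * P := by
    have hterm : ∀ p ∈ SgFinset g, Xv g (p.1 - 2) p.2 * pdDerivation g p (Xv g 2 0 * P) =
        Xv g 2 0 * (Xv g (p.1 - 2) p.2 * pdDerivation g p P)
        + if p = (2, 0) then C (g : ℚ) * P else 0 := by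
      intro p hp
      rw [hpd p hp]
      split_ifs with h
      · simp only [h, sub_self, Xv_zero_zero]
        ring
      · ring
    rw [Finset.sum_congr rfl hterm, Finset.sum_add_distrib, ← Finset.mul_sum,
      Finset.sum_ite_eq', if_pos (mem_SgFinset.2 h20)]
  rw [Fop_eq, Fop_eq, Eop, Eop, hsecond, hfirst, mul_add, smul_sub, smul_sub, mul_smul_comm]
  have hhalf : eulerDerivation g P =
      (1 / 2 : ℚ) • eulerDerivation g P + (1 / 2 : ℚ) • eulerDerivation g P := by
    rw [← add_smul]
    norm_num
  conv_rhs => rw [hhalf]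
  abel

/-- The `sl₂` identity `[F^{n+1}, E] = -(n+1)(λ - n) F^n` on the weight space of
weight `λ = a - g`. -/
lemma Fop_iterate_succ_Eop (hg : 1 ≤ g) (n : ℕ) {a b : ℤ} {P : JacA g}
    (hP : P ∈ Acomp g a b) :
    (Fop g)^[n + 1] (Eop g P) = Eop g ((Fop g)^[n + 1] P)
      + C (-((n + 1) * ((a : ℚ) - g - n))) * (Fop g)^[n] P := by
  induction n generalizing a P with
  | zero =>
    simp only [zero_add, Function.iterate_one, Function.iterate_zero, id, Fop_Eop hg,
      eulerDerivation_of_mem_Acomp hP]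
    simp only [map_neg, map_mul, map_sub, map_add, map_one, Nat.cast_zero, map_zero]
    ring
  | succ n ih =>
    rw [Function.iterate_succ_apply, Fop_Eop hg, eulerDerivation_of_mem_Acomp hP, ← sub_mul,
      ← C_sub, Fop_iterate_add, Fop_iterate_C_mul, ih (Fop_mem_Acomp hP),
      ← Function.iterate_succ_apply, ← Function.iterate_succ_apply, add_assoc, ← add_mul,
      ← C_add]
    congr 3
    push_cast
    ring

end Commutator

/-- The generators of `J` in degree at most `⌊g/3⌋` vanish. -/
lemma Fop_iterate_monomial_eq_zero {g : ℕ} (hg : 1 ≤ g) {i : ℕ} (hi : 3 * i ≤ g)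
    {m : JacVar g →₀ ℕ}
    (hm : (monomial m (1 : ℚ)) ∈ Acomp g (2 * (g : ℤ) + 2) (2 * (i : ℤ))) :
    (Fop g)^[g + 1] (monomial m (1 : ℚ)) = 0 := by
  classical
  have h20 := two_zero_mem_Sg hg
  have hw : Finsupp.weight (wt g) m = (2 * (g : ℤ) + 2, 2 * (i : ℤ)) := hm (by simp)
  have hm0 : m (Sum.inl ⟨(2, 0), h20⟩) ≠ 0 := by
    intro h0
    have := weight_fst_le_three_mul_snd h20 m h0
    rw [hw] at this
    simp only at this
    omega
  set m' := m - Finsupp.single (Sum.inl ⟨(2, 0), h20⟩) 1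
  have hE : (monomial m (1 : ℚ) : JacA g) = Eop g (monomial m' 1) := by
    rw [Eop, Xv, dif_pos h20, X, monomial_mul, mul_one, add_comm,
      Finsupp.sub_add_single_one_cancel hm0]
  have hm' : (monomial m' (1 : ℚ) : JacA g) ∈ Acomp g (2 * (g : ℤ)) (2 * (i : ℤ)) := by
    refine isWeightedHomogeneous_monomial _ _ _ ?_
    have := Finsupp.weight_sub_single_add (w := wt g) hm0
    rw [hw] at this
    simpa [wt, Prod.ext_iff] using this
  rw [hE, Fop_iterate_succ_Eop hg g hm',
    eq_zero_of_mem_Acomp_of_neg (by push_cast; omega) (Fop_iterate_mem_Acomp hm' (g + 1))]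
  push_cast
  rw [show (-(((g : ℚ) + 1) * (2 * (g : ℚ) - g - g))) = 0 by ring]
  simp [Eop]

lemma coeff_eq_zero_of_mem_Jid {g : ℕ} (hg : 1 ≤ g) {i : ℕ} (hi : 3 * i ≤ g) {b : Bsub g}
    (hb : b ∈ Jid g) (d : JacVar g →₀ ℕ) (hd : (Finsupp.weight (wt g) d).2 ≤ 2 * (i : ℤ)) :
    coeff d (b : JacA g) = 0 := by
  classical
  induction hb using Submodule.span_induction generalizing d with
  | mem b hb =>
    obtain ⟨k, m, hm, hbm⟩ := hb
    rw [hbm]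
    by_cases hk : k ≤ i
    · rw [Fop_iterate_monomial_eq_zero hg (by omega) hm, coeff_zero]
    · refine IsWeightedHomogeneous.coeff_eq_zero (Fop_iterate_mem_Acomp hm (g + 1)) d fun h => ?_
      rw [h] at hd
      simp only at hd
      omega
  | zero => simp
  | add x y _ _ hx hy => simp [hx d hd, hy d hd]
  | smul r x _ hx =>
    rw [smul_eq_mul, MulMemClass.coe_mul, coeff_mul]
    refine Finset.sum_eq_zero fun e he => ?_
    have hsum := congrArg Prod.snd (congrArg (Finsupp.weight (wt g))
      (Finset.HasAntidiagonal.mem_antidiagonal.1 he))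
    rw [map_add, Prod.snd_add] at hsum
    have := weight_snd_nonneg e.1
    rw [hx e.2 (by omega), mul_zero]

/-- For `0 ≤ i ≤ ⌊g/3⌋` one has `J ∩ 𝒜_{(0,2i)} = 0`: the quotient map
`B → B/J` is injective on the component `𝒜_{(0,2i)}`. -/
theorem statement_4 (g : ℕ) (hg : 1 ≤ g) (i : ℕ) (hi : i ≤ g / 3)
    (b : Bsub g) (hbJ : b ∈ Jid g) (hb : (b : JacA g) ∈ Acomp g 0 (2 * (i : ℤ))) :
    b = 0 := by
  ext d
  rw [ZeroMemClass.coe_zero, coeff_zero]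
  by_cases hd : Finsupp.weight (wt g) d = (0, 2 * (i : ℤ))
  · exact coeff_eq_zero_of_mem_Jid hg (i := i) (by omega) hbJ d (by rw [hd])
  · exact IsWeightedHomogeneous.coeff_eq_zero hb d hd
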